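/- arXiv:2209.04302 — 2 statements merged into one kernel-verified Lean document; each statement's English description precedes it below -/
import Mathlib

section
/- For every odd prime p there exists a generator path for p; consequently f(K_p) ≤ p for every odd prime p. -/
open SimpleGraph Finset

/-- `A` separates edges `e` and `e'`: exactly one of them lies in `A`. -/
def EdgeSeparates {V : Type*} (A : Finset (Sym2 V)) (e e' : Sym2 V) : Prop :=
  (e ∈ A ∧ e' ∉ A) ∨ (e' ∈ A ∧ e ∉ A)

/-- `P` is the edge set of a path in `G`. -/
def IsPathEdgeSet {V : Type*} [DecidableEq V] (G : SimpleGraph V) (P : Finset (Sym2 V)) : Prop :=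
  ∃ (u v : V) (w : G.Walk u v), w.IsPath ∧ P = w.edges.toFinset

/-- A separating system of `G`: a family of edge subsets separating every pair of
distinct edges of `G`. -/
def IsSepSystem {V : Type*} (G : SimpleGraph V) (S : Finset (Finset (Sym2 V))) : Prop :=
  (∀ P ∈ S, ∀ e ∈ P, e ∈ G.edgeSet) ∧
  ∀ e ∈ G.edgeSet, ∀ e' ∈ G.edgeSet, e ≠ e' → ∃ P ∈ S, EdgeSeparates P e e'

/-- A separating path system of `G`. -/
def IsSepPathSystem {V : Type*} [DecidableEq V] (G : SimpleGraph V)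
    (S : Finset (Finset (Sym2 V))) : Prop :=
  (∀ P ∈ S, IsPathEdgeSet G P) ∧
  ∀ e ∈ G.edgeSet, ∀ e' ∈ G.edgeSet, e ≠ e' → ∃ P ∈ S, EdgeSeparates P e e'

/-- `f(G)`: minimum size of a separating path system of `G`. -/
noncomputable def sepPathNumber {V : Type*} [DecidableEq V] (G : SimpleGraph V) : ℕ :=
  sInf {k | ∃ S : Finset (Finset (Sym2 V)), IsSepPathSystem G S ∧ S.card = k}

/-- Clockwise distance between two vertices of `ZMod n`. -/
def cdist (n : ℕ) (v u : ZMod n) : ℕ := min (v - u).val (u - v).val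

/-- The type of an edge of `K_n` with vertex set `ZMod n`. -/
def edgeType (n : ℕ) : Sym2 (ZMod n) → ℕ :=
  Sym2.lift ⟨fun u v => cdist n u v, fun u v => min_comm _ _⟩

/-- Number of edges of type `x` in `E`. -/
def typeCount (n : ℕ) (E : Finset (Sym2 (ZMod n))) (x : ℕ) : ℕ :=
  (E.filter fun e => edgeType n e = x).card

/-- The rotation of an edge set by `i`. -/
def rotEdges (n : ℕ) (i : ZMod n) (E : Finset (Sym2 (ZMod n))) : Finset (Sym2 (ZMod n)) :=
  E.image (Sym2.map (· + i))

/-- (GP1): at least one edge of each type. -/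
def GP1 (n : ℕ) (E : Finset (Sym2 (ZMod n))) : Prop :=
  ∀ x : ℕ, 1 ≤ x → x ≤ (n - 1) / 2 → 1 ≤ typeCount n E x

/-- (GP2): at most one type appears exactly once, no type more than twice. -/
def GP2 (n : ℕ) (E : Finset (Sym2 (ZMod n))) : Prop :=
  (∀ x : ℕ, typeCount n E x ≤ 2) ∧ {x : ℕ | typeCount n E x = 1}.Subsingleton

/-- (GP3): clockwise distances between same-type pairs are distinct across types. -/
def GP3 (n : ℕ) (E : Finset (Sym2 (ZMod n))) : Prop :=
  ∀ x y : ℕ, x ≠ y → ∀ v v' u u' : ZMod n,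
    edgeType n s(v, v + (x : ZMod n)) = x →
    edgeType n s(u, u + (y : ZMod n)) = y →
    s(v, v + (x : ZMod n)) ∈ E → s(v', v' + (x : ZMod n)) ∈ E → v ≠ v' →
    s(u, u + (y : ZMod n)) ∈ E → s(u', u' + (y : ZMod n)) ∈ E → u ≠ u' →
    cdist n v v' ≠ cdist n u u'

/-- A generator path for odd `n`. -/
def IsGenPath (n : ℕ) (E : Finset (Sym2 (ZMod n))) : Prop :=
  IsPathEdgeSet (⊤ : SimpleGraph (ZMod n)) E ∧ GP1 n E ∧ GP2 n E ∧ GP3 n E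

/-- A sequence that is injective on `[0, n]` traces a path in the complete graph. -/
lemma aux_path {V : Type*} [DecidableEq V] (f : ℕ → V) (n : ℕ)
    (hf : ∀ i j, i ≤ n → j ≤ n → f i = f j → i = j) :
    ∃ w : (⊤ : SimpleGraph V).Walk (f 0) (f n),
      w.support = (List.range (n + 1)).map f ∧
      w.edges = (List.range n).map (fun i => s(f i, f (i + 1))) := by
  induction n with
  | zero => exact ⟨Walk.nil, by simp, by simp⟩
  | succ n ih =>
    obtain ⟨w, h1, h2⟩ := ih (fun i j hi hj h => hf i j (by omega) (by omega) h)
    have hadj : (⊤ : SimpleGraph V).Adj (f n) (f (n + 1)) := by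
      rw [top_adj]
      intro h
      have := hf n (n + 1) (by omega) (by omega) h
      omega
    refine ⟨w.concat hadj, ?_, ?_⟩
    · rw [Walk.support_concat, h1, List.range_succ (n := n + 1)]
      simp
    · rw [Walk.edges_concat, h2, List.range_succ]
      simp

lemma aux_pathEdgeSet {V : Type*} [DecidableEq V] (f : ℕ → V) (n : ℕ)
    (hf : ∀ i j, i ≤ n → j ≤ n → f i = f j → i = j) :
    IsPathEdgeSet (⊤ : SimpleGraph V)
      ((Finset.range n).image (fun i => s(f i, f (i + 1)))) := by
  obtain ⟨w, h1, h2⟩ := aux_path f n hf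
  refine ⟨_, _, w, ?_, ?_⟩
  · rw [Walk.isPath_def, h1]
    refine List.Nodup.map_on ?_ List.nodup_range
    intro i hi j hj h
    rw [List.mem_range] at hi hj
    exact hf i j (by omega) (by omega) h
  · ext e
    simp [h2]

lemma cdist_eq {p : ℕ} [Fact p.Prime] (a b : ZMod p) :
    cdist p a b = (a - b).valMinAbs.natAbs := by
  rw [ZMod.valMinAbs_natAbs_eq_min, cdist]
  by_cases h : a - b = 0
  · have h' : b - a = 0 := by rw [← neg_sub, h, neg_zero]
    simp [h, h']
  · have h' : b - a = -(a - b) := by ring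
    have : NeZero (a - b) := ⟨h⟩
    rw [h', ZMod.val_neg_of_ne_zero]

lemma cdist_iff {p : ℕ} [Fact p.Prime] (a b c d : ZMod p) :
    cdist p a b = cdist p c d ↔ a - b = c - d ∨ a - b = -(c - d) := by
  rw [cdist_eq, cdist_eq]
  constructor
  · intro h
    rcases Int.natAbs_eq_natAbs_iff.1 h with h | h
    · left
      rw [← ZMod.coe_valMinAbs (a - b), h, ZMod.coe_valMinAbs]
    · right
      rw [← ZMod.coe_valMinAbs (a - b), h, Int.cast_neg, ZMod.coe_valMinAbs]
  · rintro (h | h)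
    · rw [h]
    · rw [h, ZMod.natAbs_valMinAbs_neg]

lemma cdist_nat {p : ℕ} [Fact p.Prime] (x : ℕ) (hx : x ≤ (p - 1) / 2) (a b : ZMod p)
    (h : a - b = x ∨ a - b = -x) : cdist p a b = x := by
  have hp : 0 < p := (Fact.out : p.Prime).pos
  have : cdist p a b = cdist p (x : ZMod p) 0 := by
    rw [cdist_iff]; simpa using h
  rw [this, cdist_eq, ZMod.valMinAbs_natAbs_eq_min, sub_zero, ZMod.val_natCast_of_lt (by omega)]
  omega

lemma type_mk {p : ℕ} (a b : ZMod p) : edgeType p s(a, b) = cdist p a b := rfl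

section
variable {p : ℕ} [Fact p.Prime] (g : ZMod p)

/-- The rotated generator path. -/
def gE (c : ZMod p) : Finset (Sym2 (ZMod p)) :=
  (Finset.range (p - 2)).image (fun i => s(g ^ i + c, g ^ (i + 1) + c))

/-- `g` is a primitive root. -/
def Prim : Prop := (∀ i j, i < p - 1 → j < p - 1 → g ^ i = g ^ j → i = j) ∧
  (∀ a : ZMod p, a ≠ 0 → ∃ i < p - 1, g ^ i = a) ∧ g ≠ 0 ∧ g ^ (p - 1) = 1

lemma exists_prim : ∃ g : ZMod p, Prim g := by
  obtain ⟨u, hu⟩ := IsCyclic.exists_generator (α := (ZMod p)ˣ)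
  have ho : orderOf u = p - 1 := by
    rw [orderOf_eq_card_of_forall_mem_zpowers hu, Nat.card_eq_fintype_card, ZMod.card_units]
  have hp := (Fact.out : p.Prime).two_le
  refine ⟨u, ?_, ?_, u.ne_zero, ?_⟩
  · intro i j hi hj h
    rw [← Units.val_pow_eq_pow_val, ← Units.val_pow_eq_pow_val, Units.val_inj] at h
    exact pow_injOn_Iio_orderOf (by simpa [ho] using hi) (by simpa [ho] using hj) h
  · intro a ha
    have h1 := hu (Units.mk0 a ha)
    rw [← mem_powers_iff_mem_zpowers, mem_powers_iff_mem_range_orderOf, ho] at h1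
    simp only [Finset.mem_image, Finset.mem_range] at h1
    obtain ⟨i, hi, h⟩ := h1
    refine ⟨i, hi, ?_⟩
    rw [← Units.val_pow_eq_pow_val, h]
    rfl
  · rw [← Units.val_pow_eq_pow_val, ← ho, pow_orderOf_eq_one]
    rfl

variable {g}

lemma mem_gE (hp3 : 3 ≤ p) (hg : Prim g) (c : ZMod p) (e : Sym2 (ZMod p)) :
    e ∈ gE g c ↔ ∃ a : ZMod p, a ≠ 0 ∧ g * a ≠ 1 ∧ e = s(a + c, g * a + c) := by
  obtain ⟨h1, h2, h3, h4⟩ := hg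
  simp only [gE, Finset.mem_image, Finset.mem_range]
  constructor
  · rintro ⟨i, hi, rfl⟩
    refine ⟨g ^ i, pow_ne_zero _ h3, ?_, by rw [pow_succ']⟩
    intro h
    rw [← pow_succ', ← pow_zero g] at h
    have := h1 _ _ (by omega) (by omega) h
    omega
  · rintro ⟨a, ha, ha', rfl⟩
    obtain ⟨i, hi, rfl⟩ := h2 a ha
    refine ⟨i, ?_, by rw [pow_succ']⟩
    by_contra hlt
    have : i + 1 = p - 1 := by omega
    rw [← pow_succ', this] at ha'
    exact ha' h4

lemma path_gE (hp3 : 3 ≤ p) (hg : Prim g) (c : ZMod p) :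
    IsPathEdgeSet (⊤ : SimpleGraph (ZMod p)) (gE g c) := by
  refine aux_pathEdgeSet (fun i => g ^ i + c) (p - 2) ?_
  intro i j hi hj h
  exact hg.1 i j (by omega) (by omega) (add_right_cancel h)

lemma g_ne_one (hp3 : 3 ≤ p) (hg : Prim g) : g - 1 ≠ 0 := by
  intro h
  have h : g = 1 := sub_eq_zero.1 h
  have := hg.1 0 1 (by omega) (by omega) (by simp [h])
  omega

lemma two_ne (hp3 : 3 ≤ p) : (2 : ZMod p) ≠ 0 := by
  intro h
  have : ((2 : ℕ) : ZMod p) = 0 := by exact_mod_cast h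
  rw [ZMod.natCast_eq_zero_iff] at this
  have := Nat.le_of_dvd (by norm_num) this
  omega

lemma g_neg (hg : Prim g) (h : g + 1 = 0) (a : ZMod p) (ha : a ≠ 0) :
    g * a = 1 ∨ g * a = -1 := by
  obtain ⟨i, -, rfl⟩ := hg.2.1 a ha
  have : g = -1 := eq_neg_of_add_eq_zero_left h
  rw [this]
  rcases neg_one_pow_eq_or (ZMod p) i with h | h <;> simp [h]

/-- Membership with orientation. -/
lemma mem_gE_mk (hp3 : 3 ≤ p) (hg : Prim g) (c v t : ZMod p) :
    s(v, v + t) ∈ gE g c ↔ ∃ a : ZMod p, a ≠ 0 ∧ g * a ≠ 1 ∧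
      ((v = a + c ∧ t = (g - 1) * a) ∨ (v = g * a + c ∧ t = -((g - 1) * a))) := by
  rw [mem_gE hp3 hg]
  refine exists_congr fun a => and_congr_right fun _ => and_congr_right fun _ => ?_
  rw [Sym2.eq_iff]
  constructor
  · rintro (⟨h, h'⟩ | ⟨h, h'⟩)
    · exact Or.inl ⟨h, by linear_combination h' - h⟩
    · exact Or.inr ⟨h, by linear_combination h' - h⟩
  · rintro (⟨h, h'⟩ | ⟨h, h'⟩)
    · exact Or.inl ⟨h, by linear_combination h' + h⟩
    · exact Or.inr ⟨h, by linear_combination h' + h⟩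

/-- Two translates of the same oriented edge in `E`. -/
lemma two_mem (hp3 : 3 ≤ p) (hg : Prim g) (c c' v v' t : ZMod p)
    (h : s(v, v + t) ∈ gE g c) (h' : s(v', v' + t) ∈ gE g c') (hne : v - c ≠ v' - c') :
    (((v - c) - (v' - c')) * (g - 1) = (g + 1) * t ∨
     ((v - c) - (v' - c')) * (g - 1) = -((g + 1) * t)) ∧ (v - c) + (v' - c') = -t := by
  rw [mem_gE_mk hp3 hg] at h h'
  have h1 := g_ne_one hp3 hg
  obtain ⟨a, -, -, ha⟩ := h
  obtain ⟨b, -, -, hb⟩ := h'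
  rcases ha with ⟨ha, ha'⟩ | ⟨ha, ha'⟩ <;> rcases hb with ⟨hb, hb'⟩ | ⟨hb, hb'⟩
  · have : a = b := mul_left_cancel₀ h1 (by rw [← ha', hb'])
    exact absurd (by rw [ha, hb, this]; ring) hne
  · have : a = -b := mul_left_cancel₀ h1 (by rw [← ha', hb']; ring)
    subst ha hb ha' this
    exact ⟨Or.inl (by ring), by ring⟩
  · have : a = -b := mul_left_cancel₀ h1 (by linear_combination ha' - hb')
    subst ha hb ha' this
    exact ⟨Or.inr (by ring), by ring⟩
  · have : a = b := mul_left_cancel₀ h1 (by linear_combination ha' - hb')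
    exact absurd (by rw [ha, hb, this]; ring) hne

lemma type_ga (a b : ZMod p) :
    edgeType p s(a, g * a) = edgeType p s(b, g * b) ↔ (g - 1) * a = (g - 1) * b ∨
      (g - 1) * a = -((g - 1) * b) := by
  rw [type_mk, type_mk, cdist_iff]
  constructor
  · rintro (h | h)
    · left; linear_combination -h
    · right; linear_combination -h
  · rintro (h | h)
    · left; linear_combination -h
    · right; linear_combination -h

lemma gen_gE (hp3 : 3 ≤ p) (hg : Prim g) : IsGenPath p (gE g 0) := by
  have h1 := g_ne_one hp3 hg
  have h2 := two_ne (p := p) hp3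
  have hself : ∀ a : ZMod p, a ≠ 0 → a = -a → False := by
    intro a ha h
    have : 2 * a = 0 := by linear_combination h
    exact (mul_ne_zero h2 ha) this
  have hmem : ∀ e, e ∈ gE g 0 ↔ ∃ a : ZMod p, a ≠ 0 ∧ g * a ≠ 1 ∧ e = s(a, g * a) := by
    intro e
    simpa using mem_gE hp3 hg 0 e
  refine ⟨path_gE hp3 hg 0, ?_, ⟨?_, ?_⟩, ?_⟩
  · intro x hx hx'
    have hx0 : (x : ZMod p) ≠ 0 := by
      intro h
      rw [ZMod.natCast_eq_zero_iff] at h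
      have := Nat.le_of_dvd (by omega) h
      omega
    rw [typeCount, Nat.one_le_iff_ne_zero, Finset.card_ne_zero]
    have hd : (g - 1) * ((x : ZMod p) / (g - 1)) = x := by field_simp
    set a := (x : ZMod p) / (g - 1)
    have ha : a ≠ 0 := by
      intro h; rw [h, mul_zero] at hd; exact hx0 hd.symm
    by_cases hga : g * a = 1
    · refine ⟨s(-a, g * -a), Finset.mem_filter.2 ⟨(hmem _).2 ⟨-a, neg_ne_zero.2 ha, ?_, rfl⟩, ?_⟩⟩
      · intro h
        exact hself (g * a) (by rw [hga]; exact one_ne_zero) (by linear_combination hga - h)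
      · exact cdist_nat x hx' _ _ (Or.inl (by linear_combination hd))
    · refine ⟨s(a, g * a), Finset.mem_filter.2 ⟨(hmem _).2 ⟨a, ha, hga, rfl⟩, ?_⟩⟩
      exact cdist_nat x hx' _ _ (Or.inr (by linear_combination -hd))
  · intro x
    rw [typeCount]
    rcases Finset.eq_empty_or_nonempty ((gE g 0).filter fun e => edgeType p e = x) with h | ⟨e, he⟩
    · rw [h]; simp
    · rw [Finset.mem_filter, hmem] at he
      obtain ⟨⟨a, ha, hga, rfl⟩, hx⟩ := he
      refine (Finset.card_le_card (t := {s(a, g * a), s(-a, g * -a)}) ?_).trans Finset.card_le_two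
      intro e he
      rw [Finset.mem_filter, hmem] at he
      obtain ⟨⟨b, hb, hgb, rfl⟩, hx'⟩ := he
      rw [← hx, type_ga] at hx'
      rw [Finset.mem_insert, Finset.mem_singleton]
      rcases hx' with h | h
      · left; rw [mul_left_cancel₀ h1 h]
      · right; rw [mul_left_cancel₀ h1 (h.trans (mul_neg _ _).symm)]
  · have key : ∀ x, typeCount p (gE g 0) x = 1 → x = edgeType p s(g⁻¹, g * g⁻¹) := by
      intro x hx
      rw [typeCount, Finset.card_eq_one] at hx
      obtain ⟨e, he⟩ := hx
      have hee : e ∈ (gE g 0).filter fun e => edgeType p e = x := by rw [he]; simp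
      rw [Finset.mem_filter, hmem] at hee
      obtain ⟨⟨a, ha, hga, rfl⟩, hx⟩ := hee
      by_cases hn : g * -a = 1
      · have : a = -g⁻¹ := by
          apply mul_left_cancel₀ hg.2.2.1
          rw [mul_neg, mul_inv_cancel₀ hg.2.2.1]
          linear_combination -hn
        rw [← hx, type_ga]
        right; rw [this]; ring
      · exfalso
        have hm : s(-a, g * -a) ∈ (gE g 0).filter fun e => edgeType p e = x := by
          rw [Finset.mem_filter, hmem]
          refine ⟨⟨-a, neg_ne_zero.2 ha, hn, rfl⟩, ?_⟩
          rw [← hx, type_ga]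
          right; ring
        rw [he, Finset.mem_singleton, Sym2.eq_iff] at hm
        rcases hm with ⟨h, -⟩ | ⟨h, -⟩
        · exact hself a ha h.symm
        · have : g + 1 = 0 := by
            have : (g + 1) * a = 0 := by linear_combination -h
            exact (mul_eq_zero.1 this).resolve_right ha
          rcases g_neg hg this a ha with h' | h'
          · exact hga h'
          · exact hn (by linear_combination -h')
    intro x hx y hy
    rw [key x hx, key y hy]
  · intro x y hxy v v' u u' hx hy hv hv' hvv hu hu' huu hc
    have hA := (two_mem hp3 hg 0 0 v v' x hv hv' (by simpa using hvv)).1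
    have hB := (two_mem hp3 hg 0 0 u u' y hu hu' (by simpa using huu)).1
    simp only [sub_zero] at hA hB
    have hg1 : g + 1 ≠ 0 := by
      intro h
      have : (v - v') * (g - 1) ≠ 0 := mul_ne_zero (sub_ne_zero.2 hvv) h1
      rw [h] at hA
      simp [this] at hA
    rw [cdist_iff] at hc
    apply hxy
    rw [← hx, ← hy, type_mk, type_mk, cdist_iff]
    have : (x : ZMod p) = y ∨ (x : ZMod p) = -y := by
      rcases hA with hA | hA <;> rcases hB with hB | hB <;> rcases hc with hc | hc <;>
        rw [hc] at hA
      · left; exact mul_left_cancel₀ hg1 (by linear_combination hB - hA)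
      · right; exact mul_left_cancel₀ hg1 (by linear_combination -hB - hA)
      · right; exact mul_left_cancel₀ hg1 (by linear_combination hB - hA)
      · left; exact mul_left_cancel₀ hg1 (by linear_combination -hB - hA)
      · right; exact mul_left_cancel₀ hg1 (by linear_combination -hB + hA)
      · left; exact mul_left_cancel₀ hg1 (by linear_combination hB + hA)
      · left; exact mul_left_cancel₀ hg1 (by linear_combination -hB + hA)
      · right; exact mul_left_cancel₀ hg1 (by linear_combination hB + hA)
    rcases this with h | h
    · left; linear_combination -h
    · right; linear_combination -h

/-- Case of an edge lying in two rotations. -/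
lemma sep_two (hp3 : 3 ≤ p) (hg : Prim g) (v t u r a : ZMod p) (ha : a ≠ 0)
    (ht : t = (g - 1) * a) (h1 : g * a ≠ 1) (h2 : g * -a ≠ 1)
    (H : ∀ c, s(v, v + t) ∈ gE g c → s(u, u + r) ∈ gE g c) :
    s(v, v + t) = s(u, u + r) := by
  have hg1 : g + 1 ≠ 0 := by
    intro h
    rcases g_neg hg h a ha with h' | h'
    · exact h1 h'
    · exact h2 (by linear_combination -h')
  have m1 : s(v, v + t) ∈ gE g (v - a) :=
    (mem_gE_mk hp3 hg _ _ _).2 ⟨a, ha, h1, Or.inl ⟨by ring, ht⟩⟩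
  have m2 : s(v, v + t) ∈ gE g (v - g * -a) :=
    (mem_gE_mk hp3 hg _ _ _).2 ⟨-a, neg_ne_zero.2 ha, h2, Or.inr ⟨by ring, by rw [ht]; ring⟩⟩
  have hne : v - a ≠ v - g * -a := by
    intro h
    have : (g + 1) * a = 0 := by linear_combination -h
    exact mul_ne_zero hg1 ha this
  obtain ⟨hA, hB⟩ := two_mem hp3 hg _ _ _ _ _ (H _ m1) (H _ m2)
    (by intro h; exact hne (by linear_combination -h))
  have hrt : t = r ∨ t = -r := by
    rcases hA with h | h
    · left; exact mul_left_cancel₀ hg1 (by rw [ht]; linear_combination h)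
    · right; exact mul_left_cancel₀ hg1 (by rw [ht]; linear_combination h)
  have h2' := two_ne (p := p) hp3
  rw [Sym2.eq_iff]
  rcases hrt with h | h
  · left
    have : v = u := mul_left_cancel₀ h2' (by linear_combination -hB - h + ht)
    exact ⟨this, by rw [this, h]⟩
  · right
    have : v = u + r := mul_left_cancel₀ h2' (by linear_combination -hB - h + ht)
    exact ⟨this, by rw [this, h]; ring⟩

/-- An edge lying in one rotation only. -/
lemma sep_one (hp3 : 3 ≤ p) (hg : Prim g) (v t a c : ZMod p)
    (ht : t = (g - 1) * a) (h1 : g * a = 1 ∨ g * -a = 1) (h : s(v, v + t) ∈ gE g c) :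
    s(v, v + t) = s(-1 + c, -g⁻¹ + c) := by
  have hg1 := g_ne_one hp3 hg
  have hi : g * g⁻¹ = 1 := mul_inv_cancel₀ hg.2.2.1
  rw [mem_gE hp3 hg] at h
  obtain ⟨b, hb, hgb, h⟩ := h
  have hb' : a = b ∨ a = -b := by
    rw [Sym2.eq_iff] at h
    rcases h with ⟨h, h'⟩ | ⟨h, h'⟩
    · left; exact mul_left_cancel₀ hg1 (by rw [← ht]; linear_combination h' - h)
    · right; exact mul_left_cancel₀ hg1 (by rw [← ht]; linear_combination h' - h)
  have hb2 : g * b = -1 := by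
    rcases hb' with rfl | rfl
    · rcases h1 with h1 | h1
      · exact absurd h1 hgb
      · linear_combination -h1
    · rcases h1 with h1 | h1
      · linear_combination -h1
      · exact absurd (by simpa using h1) hgb
  have hb3 : b = -g⁻¹ := mul_left_cancel₀ hg.2.2.1 (by linear_combination hb2 + hi)
  rw [h, hb2, hb3, Sym2.eq_swap]

lemma exists_rot (hp3 : 3 ≤ p) (hg : Prim g) (v t a : ZMod p) (ha : a ≠ 0)
    (ht : t = (g - 1) * a) : ∃ c, s(v, v + t) ∈ gE g c := by
  by_cases h1 : g * a = 1
  · refine ⟨v - g * -a, (mem_gE_mk hp3 hg _ _ _).2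
      ⟨-a, neg_ne_zero.2 ha, ?_, Or.inr ⟨by ring, by rw [ht]; ring⟩⟩⟩
    intro h
    exact two_ne (p := p) hp3 (by linear_combination -h - h1)
  · exact ⟨v - a, (mem_gE_mk hp3 hg _ _ _).2 ⟨a, ha, h1, Or.inl ⟨by ring, ht⟩⟩⟩

lemma sep_all (hp3 : 3 ≤ p) (hg : Prim g) (v t u r : ZMod p) (ht0 : t ≠ 0) (hr0 : r ≠ 0)
    (H : ∀ c, s(v, v + t) ∈ gE g c ↔ s(u, u + r) ∈ gE g c) :
    s(v, v + t) = s(u, u + r) := by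
  have hg1 := g_ne_one hp3 hg
  obtain ⟨a, ht⟩ : ∃ a, t = (g - 1) * a := ⟨t / (g - 1), by field_simp⟩
  obtain ⟨b, hr⟩ : ∃ b, r = (g - 1) * b := ⟨r / (g - 1), by field_simp⟩
  have ha : a ≠ 0 := by rintro rfl; simp at ht; exact ht0 ht
  have hb : b ≠ 0 := by rintro rfl; simp at hr; exact hr0 hr
  by_cases h1 : g * a = 1 ∨ g * -a = 1
  · by_cases h2 : g * b = 1 ∨ g * -b = 1
    · obtain ⟨c, hc⟩ := exists_rot hp3 hg v t a ha ht
      rw [sep_one hp3 hg v t a c ht h1 hc, sep_one hp3 hg u r b c hr h2 ((H c).1 hc)]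
    · push Not at h2
      exact (sep_two hp3 hg u r v t b hb hr h2.1 h2.2 (fun c => (H c).2)).symm
  · push Not at h1
    exact sep_two hp3 hg v t u r a ha ht h1.1 h1.2 (fun c => (H c).1)

end

/-- For every odd prime `p` there is a generator path for `p`; hence `f(K_p) ≤ p`. -/
theorem stmt9 (p : ℕ) (hp : p.Prime) (hodd : Odd p) :
    (∃ E : Finset (Sym2 (ZMod p)), IsGenPath p E) ∧
    sepPathNumber (⊤ : SimpleGraph (ZMod p)) ≤ p := by
  have : Fact p.Prime := ⟨hp⟩
  have hp3 : 3 ≤ p := by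
    have := hp.two_le
    obtain ⟨k, hk⟩ := hodd
    omega
  obtain ⟨g, hg⟩ := exists_prim (p := p)
  refine ⟨⟨gE g 0, gen_gE hp3 hg⟩, ?_⟩
  have hS : IsSepPathSystem (⊤ : SimpleGraph (ZMod p)) (Finset.univ.image (gE g)) := by
    refine ⟨?_, ?_⟩
    · intro P hP
      obtain ⟨c, -, rfl⟩ := Finset.mem_image.1 hP
      exact path_gE hp3 hg c
    · intro e he e' he' hne
      induction e using Sym2.ind with
      | _ v w =>
      induction e' using Sym2.ind with
      | _ u z =>
      by_contra hcon
      push Not at hcon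
      rw [mem_edgeSet, top_adj] at he he'
      have hv : w = v + (w - v) := by ring
      have hu : z = u + (z - u) := by ring
      apply hne
      rw [hv, hu]
      refine sep_all hp3 hg v (w - v) u (z - u) (sub_ne_zero.2 (Ne.symm he))
        (sub_ne_zero.2 (Ne.symm he')) ?_
      intro c
      have := hcon (gE g c) (Finset.mem_image_of_mem _ (Finset.mem_univ c))
      rw [← hv, ← hu]
      unfold EdgeSeparates at this
      tauto
  have h1 : sepPathNumber (⊤ : SimpleGraph (ZMod p)) ≤ (Finset.univ.image (gE g)).card :=
    Nat.sInf_le ⟨_, hS, rfl⟩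
  refine h1.trans (Finset.card_image_le.trans ?_)
  rw [Finset.card_univ, ZMod.card]
end

section
/- Let p be an odd prime. Then f(K_{p+1}) ≤ p+1: there is a separating path system for K_{p+1} of size p+1 obtained by extending each rotation of a generator path for K_p with an edge to the extra vertex and adding one path of 1-type edges. -/
open SimpleGraph Finset

/-- Edges of the vertex sequence `f 0, …, f m`. -/
def pathSet {V : Type*} [DecidableEq V] (f : ℕ → V) (m : ℕ) : Finset (Sym2 V) :=
  (Finset.range m).image (fun i => s(f i, f (i + 1)))

lemma mem_pathSet {V : Type*} [DecidableEq V] (f : ℕ → V) (m : ℕ) (e : Sym2 V) :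
    e ∈ pathSet f m ↔ ∃ i < m, s(f i, f (i + 1)) = e := by
  simp [pathSet]

lemma pathSet_isPath {V : Type*} [DecidableEq V] (f : ℕ → V) (m : ℕ)
    (hf : ∀ i ≤ m, ∀ j ≤ m, f i = f j → i = j) :
    IsPathEdgeSet (⊤ : SimpleGraph V) (pathSet f m) := by
  have key : ∀ k ≤ m, ∃ w : (⊤ : SimpleGraph V).Walk (f k) (f 0), w.IsPath ∧
      (∀ v ∈ w.support, ∃ i ≤ k, v = f i) ∧ pathSet f k = w.edges.toFinset := by
    intro k
    induction k with
    | zero =>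
      intro _
      exact ⟨Walk.nil, by simp, by simp, by simp [pathSet]⟩
    | succ k ih =>
      intro hk
      obtain ⟨w, hw, hs, he⟩ := ih (by omega)
      have hadj : (⊤ : SimpleGraph V).Adj (f (k + 1)) (f k) := by
        rw [SimpleGraph.top_adj]
        intro h
        have := hf _ hk _ (by omega) h
        omega
      refine ⟨Walk.cons hadj w, ?_, ?_, ?_⟩
      · rw [Walk.cons_isPath_iff]
        refine ⟨hw, fun h => ?_⟩
        obtain ⟨i, hi, h⟩ := hs _ h
        have := hf _ hk _ (by omega) h
        omega
      · intro v hv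
        rw [Walk.support_cons, List.mem_cons] at hv
        rcases hv with rfl | hv
        · exact ⟨k + 1, le_rfl, rfl⟩
        · obtain ⟨i, hi, h⟩ := hs _ hv
          exact ⟨i, by omega, h⟩
      · rw [Walk.edges_cons, List.toFinset_cons, ← he]
        unfold pathSet
        rw [Finset.range_add_one, Finset.image_insert, Sym2.eq_swap]
  obtain ⟨w, hw, _, he⟩ := key m le_rfl
  exact ⟨_, _, w, hw, he⟩

/-- Vertex sequence: extra vertex, then the geometric progression. -/
def extSeq {F V : Type*} [Field F] (ι : Option F → V) (g j : F) : ℕ → V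
  | 0 => ι none
  | k + 1 => ι (some (g ^ k + j))

/-- The rotations of the generator path, extended except for `j = 0`. -/
def rotPath {F V : Type*} [Field F] [DecidableEq F] [DecidableEq V]
    (ι : Option F → V) (p : ℕ) (g j : F) : Finset (Sym2 V) :=
  if j = 0 then pathSet (fun i => ι (some (g ^ i + j))) (p - 2)
  else pathSet (extSeq ι g j) (p - 2 + 1)

/-- The extra path. -/
def extraPath {F V : Type*} [Field F] [DecidableEq V]
    (ι : Option F → V) (p : ℕ) (g : F) : Finset (Sym2 V) :=
  pathSet (fun i => ι (some (-g⁻¹ + i * (1 - g⁻¹)))) (p - 1)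

lemma mem_rot_real {F V : Type*} [Field F] [DecidableEq F] [DecidableEq V]
    (ι : Option F ≃ V) (p : ℕ) (g j : F)
    (hpow : ∀ u : F, (∃ i < p - 2, g ^ i = u) ↔ u ≠ 0 ∧ u ≠ g⁻¹) (x y : F) :
    s(ι (some x), ι (some y)) ∈ rotPath ι p g j ↔
      ∃ u, u ≠ 0 ∧ u ≠ g⁻¹ ∧ ((x = u + j ∧ y = g * u + j) ∨ (y = u + j ∧ x = g * u + j)) := by
  have h1 : s(ι (some x), ι (some y)) ∈ rotPath ι p g j ↔
      ∃ i < p - 2, s(ι (some (g ^ i + j)), ι (some (g ^ (i + 1) + j)))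
        = s(ι (some x), ι (some y)) := by
    unfold rotPath
    split_ifs with hj
    · rw [mem_pathSet]
    · rw [mem_pathSet]
      constructor
      · rintro ⟨i, hi, h⟩
        cases i with
        | zero => simp [extSeq] at h
        | succ k => exact ⟨k, by omega, h⟩
      · rintro ⟨i, hi, h⟩
        exact ⟨i + 1, by omega, h⟩
  rw [h1]
  constructor
  · rintro ⟨i, hi, h⟩
    obtain ⟨h0, h2⟩ := (hpow (g ^ i)).1 ⟨i, hi, rfl⟩
    refine ⟨g ^ i, h0, h2, ?_⟩
    simp only [Sym2.eq_iff, EmbeddingLike.apply_eq_iff_eq, Option.some.injEq] at h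
    rw [pow_succ'] at h
    rcases h with ⟨h, h'⟩ | ⟨h, h'⟩
    · exact Or.inl ⟨h.symm, h'.symm⟩
    · exact Or.inr ⟨h.symm, h'.symm⟩
  · rintro ⟨u, h0, h2, h⟩
    obtain ⟨i, hi, rfl⟩ := (hpow u).2 ⟨h0, h2⟩
    refine ⟨i, hi, ?_⟩
    simp only [Sym2.eq_iff, EmbeddingLike.apply_eq_iff_eq, Option.some.injEq]
    rw [pow_succ']
    rcases h with ⟨h, h'⟩ | ⟨h, h'⟩
    · exact Or.inl ⟨h.symm, h'.symm⟩
    · exact Or.inr ⟨h.symm, h'.symm⟩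

lemma mem_rot_inf {F V : Type*} [Field F] [DecidableEq F] [DecidableEq V]
    (ι : Option F ≃ V) (p : ℕ) (g j : F) (v : F) :
    s(ι none, ι (some v)) ∈ rotPath ι p g j ↔ j ≠ 0 ∧ v = 1 + j := by
  unfold rotPath
  split_ifs with hj
  · rw [mem_pathSet]
    simp [hj]
  · rw [mem_pathSet]
    constructor
    · rintro ⟨i, hi, h⟩
      cases i with
      | zero => simp [extSeq] at h; exact ⟨hj, h.symm⟩
      | succ k => simp [extSeq] at h
    · rintro ⟨_, rfl⟩
      exact ⟨0, by omega, by simp [extSeq]⟩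

lemma mem_rot_param {F V : Type*} [Field F] [DecidableEq F] [DecidableEq V]
    (ι : Option F ≃ V) (p : ℕ) (g j : F) (hg1 : g ≠ 1)
    (hpow : ∀ u : F, (∃ i < p - 2, g ^ i = u) ↔ u ≠ 0 ∧ u ≠ g⁻¹) (x t : F) (ht : t ≠ 0) :
    s(ι (some x), ι (some (x + (g - 1) * t))) ∈ rotPath ι p g j ↔
      (j = x - t ∧ t ≠ g⁻¹) ∨ (j = x + g * t ∧ t ≠ -g⁻¹) := by
  rw [mem_rot_real ι p g j hpow]
  have hg : g - 1 ≠ 0 := sub_ne_zero.2 hg1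
  constructor
  · rintro ⟨u, h0, h2, ⟨h, h'⟩ | ⟨h, h'⟩⟩
    · have : u = t := by
        apply mul_left_cancel₀ hg
        linear_combination h - h'
      subst this
      exact Or.inl ⟨by rw [h]; ring, h2⟩
    · have : u = -t := by
        apply mul_left_cancel₀ hg
        linear_combination h - h'
      subst this
      refine Or.inr ⟨by rw [h']; ring, ?_⟩
      rintro rfl
      simp at h2
  · rintro (⟨rfl, h⟩ | ⟨rfl, h⟩)
    · exact ⟨t, ht, h, Or.inl ⟨by ring, by ring⟩⟩
    · refine ⟨-t, neg_ne_zero.2 ht, ?_, Or.inr ⟨by ring, by ring⟩⟩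
      intro h3
      exact h (by rw [← h3, neg_neg])

theorem main_sep {p : ℕ} [hp : Fact p.Prime] (hodd : Odd p) {V : Type*} [DecidableEq V]
    (ι : Option (ZMod p) ≃ V) :
    ∃ S : Finset (Finset (Sym2 V)), IsSepPathSystem (⊤ : SimpleGraph V) S ∧ S.card ≤ p + 1 := by
  have hp3 : 3 ≤ p := by
    have := hp.out.two_le
    obtain ⟨k, hk⟩ := hodd
    omega
  obtain ⟨G, hG⟩ := IsCyclic.exists_generator (α := (ZMod p)ˣ)
  have hord : orderOf G = p - 1 := by
    rw [orderOf_eq_card_of_forall_mem_zpowers hG, Nat.card_eq_fintype_card, ZMod.card_units]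
  obtain ⟨g, hgdef⟩ : ∃ g : ZMod p, g = (G : ZMod p) := ⟨_, rfl⟩
  have hg0 : g ≠ 0 := by rw [hgdef]; exact G.ne_zero
  have hginj : ∀ i < p - 1, ∀ j < p - 1, g ^ i = g ^ j → i = j := by
    intro i hi j hj h
    apply pow_injOn_Iio_orderOf (x := G) (by simpa [hord] using hi) (by simpa [hord] using hj)
    apply Units.ext
    simpa [hgdef] using h
  have hgp : g ^ (p - 2) = g⁻¹ := by
    apply eq_inv_of_mul_eq_one_left
    rw [← pow_succ, show p - 2 + 1 = p - 1 by omega]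
    exact ZMod.pow_card_sub_one_eq_one hg0
  have hgsurj : ∀ u : ZMod p, u ≠ 0 → ∃ i < p - 1, g ^ i = u := by
    intro u hu
    have h1 : Units.mk0 u hu ∈ Submonoid.powers G := by
      rw [mem_powers_iff_mem_zpowers]; exact hG _
    rw [mem_powers_iff_mem_range_orderOf] at h1
    simp only [Finset.mem_image, Finset.mem_range, hord] at h1
    obtain ⟨i, hi, h⟩ := h1
    refine ⟨i, hi, ?_⟩
    have := congrArg Units.val h
    simpa [hgdef] using this
  have hpow : ∀ u : ZMod p, (∃ i < p - 2, g ^ i = u) ↔ u ≠ 0 ∧ u ≠ g⁻¹ := by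
    intro u
    constructor
    · rintro ⟨i, hi, rfl⟩
      refine ⟨pow_ne_zero _ hg0, fun h => ?_⟩
      rw [← hgp] at h
      have := hginj _ (by omega) _ (by omega) h
      omega
    · rintro ⟨h0, h1⟩
      obtain ⟨i, hi, rfl⟩ := hgsurj u h0
      refine ⟨i, ?_, rfl⟩
      have : i ≠ p - 2 := by
        rintro rfl
        exact h1 hgp
      omega
  have hg1 : g ≠ 1 := by
    intro h
    have := hginj 0 (by omega) 1 (by omega) (by simp [h])
    omega
  have hgm : ∀ t : ZMod p, t ≠ 0 → t ≠ g⁻¹ → t ≠ -g⁻¹ → g + 1 ≠ 0 := by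
    intro t h0 h1 h2 h
    have hgn : g = -1 := by linear_combination h
    obtain ⟨i, hi, rfl⟩ := hgsurj t h0
    rw [hgn] at h1 h2
    rcases neg_one_pow_eq_or (ZMod p) i with h3 | h3
    · apply h2; rw [h3]; simp
    · apply h1; rw [h3]; simp
  have hd : 1 - g⁻¹ ≠ 0 := by
    intro h
    apply hg1
    have : g⁻¹ = 1 := by linear_combination -h
    simpa using this
  have hmr := fun j x t ht => mem_rot_param ι p g j hg1 hpow x t ht
  have hmi := mem_rot_inf ι p g
  have hxi : ∀ v, s(ι none, ι (some v)) ∉ extraPath ι p g := by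
    intro v
    unfold extraPath
    rw [mem_pathSet]
    simp
  have hxs : ∀ x, x + 1 ≠ 0 →
      s(ι (some x), ι (some (x + (g - 1) * g⁻¹))) ∈ extraPath ι p g := by
    intro x hx
    unfold extraPath
    rw [mem_pathSet]
    obtain ⟨k, hk, hkx⟩ : ∃ k < p, (k : ZMod p) = (x + g⁻¹) / (1 - g⁻¹) :=
      ⟨_, ZMod.val_lt _, ZMod.natCast_zmod_val _⟩
    have hkx' : (k : ZMod p) * (1 - g⁻¹) = x + g⁻¹ := by
      rw [hkx]; field_simp
    have hkp : k ≠ p - 1 := by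
      rintro rfl
      rw [Nat.cast_sub (by omega)] at hkx'
      apply hx
      simp at hkx'
      linear_combination -hkx'
    refine ⟨k, by omega, ?_⟩
    have e1 : -g⁻¹ + (k : ZMod p) * (1 - g⁻¹) = x := by rw [hkx']; ring
    have e2 : -g⁻¹ + ((k + 1 : ℕ) : ZMod p) * (1 - g⁻¹) = x + (g - 1) * g⁻¹ := by
      push_cast
      rw [sub_mul, mul_inv_cancel₀ hg0]
      linear_combination hkx'
    rw [e1, e2]
  refine ⟨insert (extraPath ι p g) (Finset.univ.image (rotPath ι p g)), ⟨?_, ?_⟩, ?_⟩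
  · intro P hP
    rw [Finset.mem_insert, Finset.mem_image] at hP
    rcases hP with rfl | ⟨j, -, rfl⟩
    · apply pathSet_isPath
      intro i hi j hj h
      simp only [EmbeddingLike.apply_eq_iff_eq, Option.some.injEq, add_right_inj] at h
      have h := mul_right_cancel₀ hd h
      rw [ZMod.natCast_eq_natCast_iff'] at h
      rwa [Nat.mod_eq_of_lt (by omega), Nat.mod_eq_of_lt (by omega)] at h
    · unfold rotPath
      split_ifs with hj
      · apply pathSet_isPath
        intro i hi j hj h
        simp only [EmbeddingLike.apply_eq_iff_eq, Option.some.injEq, add_left_inj] at h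
        exact hginj _ (by omega) _ (by omega) h
      · apply pathSet_isPath
        intro i hi k hk h
        cases i with
        | zero =>
          cases k with
          | zero => rfl
          | succ k => simp [extSeq] at h
        | succ i =>
          cases k with
          | zero => simp [extSeq] at h
          | succ k =>
            simp only [extSeq, EmbeddingLike.apply_eq_iff_eq, Option.some.injEq,
              add_left_inj] at h
            rw [hginj _ (by omega) _ (by omega) h]
  · -- classification of the edges
    have hcl : ∀ e ∈ (⊤ : SimpleGraph V).edgeSet,
        (∃ v, e = s(ι none, ι (some v))) ∨
        (∃ x, e = s(ι (some x), ι (some (x + (g - 1) * g⁻¹)))) ∨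
        (∃ x t, t ≠ 0 ∧ t ≠ g⁻¹ ∧ t ≠ -g⁻¹ ∧
          e = s(ι (some x), ι (some (x + (g - 1) * t)))) := by
      intro e
      induction e using Sym2.ind with
      | _ a b =>
        obtain ⟨a, rfl⟩ := ι.surjective a
        obtain ⟨b, rfl⟩ := ι.surjective b
        intro h
        rw [SimpleGraph.mem_edgeSet, SimpleGraph.top_adj] at h
        cases a with
        | none =>
          cases b with
          | none => exact absurd rfl h
          | some y => exact Or.inl ⟨y, rfl⟩
        | some x =>
          cases b with
          | none => exact Or.inl ⟨x, Sym2.eq_swap⟩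
          | some y =>
            right
            have hxy : x ≠ y := fun h' => h (by rw [h'])
            have hg : g - 1 ≠ 0 := sub_ne_zero.2 hg1
            obtain ⟨t, ht⟩ : ∃ t, y = x + (g - 1) * t :=
              ⟨(y - x) / (g - 1), by field_simp; ring⟩
            have ht0 : t ≠ 0 := by
              rintro rfl
              apply hxy
              simp [ht]
            subst ht
            by_cases h1 : t = g⁻¹
            · exact Or.inl ⟨x, by rw [h1]⟩
            by_cases h2 : t = -g⁻¹
            · left
              refine ⟨x + (g - 1) * t, ?_⟩
              rw [Sym2.eq_swap, h2]
              congr 4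
              ring
            · exact Or.inr ⟨x, t, ht0, h1, h2, rfl⟩
    have hgi : g⁻¹ ≠ 0 := inv_ne_zero hg0
    have h2 : (2 : ZMod p) ≠ 0 := by
      intro h
      have : ((2 : ℕ) : ZMod p) = 0 := by exact_mod_cast h
      rw [ZMod.natCast_eq_zero_iff] at this
      have := Nat.le_of_dvd (by norm_num) this
      omega
    have hgi2 : g⁻¹ ≠ -g⁻¹ := by
      intro h
      have : (2 : ZMod p) * g⁻¹ = 0 := by linear_combination h
      rcases mul_eq_zero.1 this with h | h
      · exact h2 h
      · exact hgi h
    have hms : ∀ j x, s(ι (some x), ι (some (x + (g - 1) * g⁻¹))) ∈ rotPath ι p g j ↔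
        j = x + 1 := by
      intro j x
      rw [hmr j x _ hgi, mul_inv_cancel₀ hg0]
      simp [hgi2]
    have hmd : ∀ j x t, t ≠ 0 → t ≠ g⁻¹ → t ≠ -g⁻¹ →
        (s(ι (some x), ι (some (x + (g - 1) * t))) ∈ rotPath ι p g j ↔
          j = x - t ∨ j = x + g * t) := by
      intro j x t h0 h1 h2
      rw [hmr j x _ h0]
      simp [h1, h2]
    have hdd : ∀ x t : ZMod p, t ≠ 0 → t ≠ g⁻¹ → t ≠ -g⁻¹ → x - t ≠ x + g * t := by
      intro x t h0 h1 h2 h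
      have : (g + 1) * t = 0 := by linear_combination -h
      rcases mul_eq_zero.1 this with h3 | h3
      · exact hgm t h0 h1 h2 h3
      · exact h0 h3
    clear hmr
    -- the asymmetric cases
    have hIS : ∀ v x, ¬ ((∀ j, s(ι none, ι (some v)) ∈ rotPath ι p g j ↔
          s(ι (some x), ι (some (x + (g - 1) * g⁻¹))) ∈ rotPath ι p g j) ∧
        (s(ι none, ι (some v)) ∈ extraPath ι p g ↔
          s(ι (some x), ι (some (x + (g - 1) * g⁻¹))) ∈ extraPath ι p g)) := by
      rintro v x ⟨h, h'⟩
      have := (hmi _ _).1 ((h (x + 1)).2 ((hms _ _).2 rfl))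
      exact hxi v (h'.2 (hxs x this.1))
    have hID : ∀ v x t, t ≠ 0 → t ≠ g⁻¹ → t ≠ -g⁻¹ →
        ¬ (∀ j, s(ι none, ι (some v)) ∈ rotPath ι p g j ↔
          s(ι (some x), ι (some (x + (g - 1) * t))) ∈ rotPath ι p g j) := by
      intro v x t h0 h1 h2 h
      have e1 := (hmi _ _).1 ((h (x - t)).2 ((hmd _ _ _ h0 h1 h2).2 (Or.inl rfl)))
      have e2 := (hmi _ _).1 ((h (x + g * t)).2 ((hmd _ _ _ h0 h1 h2).2 (Or.inr rfl)))
      apply hdd x t h0 h1 h2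
      linear_combination e2.2 - e1.2
    have hSD : ∀ y x t, t ≠ 0 → t ≠ g⁻¹ → t ≠ -g⁻¹ →
        ¬ (∀ j, s(ι (some y), ι (some (y + (g - 1) * g⁻¹))) ∈ rotPath ι p g j ↔
          s(ι (some x), ι (some (x + (g - 1) * t))) ∈ rotPath ι p g j) := by
      intro y x t h0 h1 h2 h
      have e1 := (hms _ _).1 ((h (x - t)).2 ((hmd _ _ _ h0 h1 h2).2 (Or.inl rfl)))
      have e2 := (hms _ _).1 ((h (x + g * t)).2 ((hmd _ _ _ h0 h1 h2).2 (Or.inr rfl)))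
      exact hdd x t h0 h1 h2 (e1.trans e2.symm)
    intro e he e' he' hne
    by_contra hcon
    have hall : ∀ P ∈ insert (extraPath ι p g) (Finset.univ.image (rotPath ι p g)),
        (e ∈ P ↔ e' ∈ P) := by
      intro P hP
      by_contra h
      apply hcon
      refine ⟨P, hP, ?_⟩
      unfold EdgeSeparates
      tauto
    have hX := hall _ (Finset.mem_insert_self _ _)
    have hR : ∀ j, e ∈ rotPath ι p g j ↔ e' ∈ rotPath ι p g j := fun j =>
      hall _ (Finset.mem_insert_of_mem (Finset.mem_image_of_mem _ (Finset.mem_univ j)))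
    have hR' := fun j => (hR j).symm
    clear hall hcon
    rcases hcl e he with ⟨v, rfl⟩ | ⟨x, rfl⟩ | ⟨x, t, h0, h1, h2, rfl⟩ <;>
    rcases hcl e' he' with ⟨v', rfl⟩ | ⟨x', rfl⟩ | ⟨x', t', h0', h1', h2', rfl⟩
    · have hv : v ≠ v' := by
        rintro rfl
        exact hne rfl
      by_cases hv1 : v = 1
      · have hv1' : v' - 1 ≠ 0 := by
          intro h
          apply hv
          rw [hv1]
          linear_combination -h
        have := (hmi _ _).1 ((hR (v' - 1)).2 ((hmi _ _).2 ⟨hv1', by ring⟩))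
        apply hv
        linear_combination this.2
      · have := (hmi _ _).1 ((hR (v - 1)).1 ((hmi _ _).2 ⟨sub_ne_zero.2 hv1, by ring⟩))
        apply hv
        linear_combination -this.2
    · exact hIS _ _ ⟨hR, hX⟩
    · exact hID _ _ _ h0' h1' h2' hR
    · exact hIS _ _ ⟨hR', hX.symm⟩
    · have := (hms _ _).1 ((hR (x + 1)).1 ((hms _ _).2 rfl))
      apply hne
      rw [add_right_cancel this]
    · exact hSD _ _ _ h0' h1' h2' hR
    · exact hID _ _ _ h0 h1 h2 hR'
    · exact hSD _ _ _ h0 h1 h2 hR'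
    · have e1 := (hmd _ _ _ h0' h1' h2').1
        ((hR (x - t)).1 ((hmd _ _ _ h0 h1 h2).2 (Or.inl rfl)))
      have e2 := (hmd _ _ _ h0' h1' h2').1
        ((hR (x + g * t)).1 ((hmd _ _ _ h0 h1 h2).2 (Or.inr rfl)))
      have hd1 := hdd x t h0 h1 h2
      have hgg := hgm t h0 h1 h2
      rcases e1 with e1 | e1 <;> rcases e2 with e2 | e2
      · exact hd1 (e1.trans e2.symm)
      · have ht : t = t' := by
          apply mul_left_cancel₀ hgg
          linear_combination e2 - e1
        subst ht
        have hx : x = x' := by linear_combination e1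
        exact hne (by rw [hx])
      · have ht : t' = -t := by
          apply mul_left_cancel₀ hgg
          linear_combination e2 - e1
        subst ht
        have hx : x' = x + (g - 1) * t := by linear_combination -e1
        subst hx
        apply hne
        rw [Sym2.eq_swap]
        congr 4
        ring
      · exact hd1 (e1.trans e2.symm)
  · refine (Finset.card_insert_le _ _).trans ?_
    have := Finset.card_image_le (s := (Finset.univ : Finset (ZMod p))) (f := rotPath ι p g)
    rw [Finset.card_univ, ZMod.card] at this
    omega

/-- For an odd prime `p`, there is a separating path system of `K_{p+1}` of size at
most `p + 1`; hence `f(K_{p+1}) ≤ p + 1`. -/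
theorem stmt10 (p : ℕ) (hp : p.Prime) (hodd : Odd p) :
    (∃ S : Finset (Finset (Sym2 (ZMod (p + 1)))),
      IsSepPathSystem (⊤ : SimpleGraph (ZMod (p + 1))) S ∧ S.card ≤ p + 1) ∧
    sepPathNumber (⊤ : SimpleGraph (ZMod (p + 1))) ≤ p + 1 := by
  have : Fact p.Prime := ⟨hp⟩
  have hcard : Fintype.card (Option (ZMod p)) = Fintype.card (ZMod (p + 1)) := by
    rw [Fintype.card_option, ZMod.card, ZMod.card]
  obtain ⟨S, hS, hc⟩ := main_sep hodd (Fintype.equivOfCardEq hcard)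
  exact ⟨⟨S, hS, hc⟩, le_trans (Nat.sInf_le (m := S.card) ⟨S, hS, rfl⟩) hc⟩
end
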